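/- For all integers i and j with |i| > 1 and |j| > 1, the Baumslag–Solitar group BS(i,j) = ⟨t, a | t aⁱ t⁻¹ = aʲ⟩ is SQ-universal. -/

import Mathlib

/-- A group `G` is SQ-universal if every countable group embeds in a quotient of `G`. -/
def SQUniversal (G : Type*) [Group G] : Prop :=
  ∀ (C : Type) [Group C] [Countable C],
    ∃ (N : Subgroup G) (_ : N.Normal), ∃ f : C →* G ⧸ N, Function.Injective f

/-- The single relator `t aⁱ t⁻¹ a⁻ʲ` of the Baumslag–Solitar group `BS(i,j)`, where
`t` is the generator `0` and `a` is the generator `1` of the free group on `Fin 2`. -/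
def bsRels (i j : ℤ) : Set (FreeGroup (Fin 2)) :=
  {FreeGroup.of 0 * FreeGroup.of 1 ^ i * (FreeGroup.of 0)⁻¹ * FreeGroup.of 1 ^ (-j)}

/-- The Baumslag–Solitar group `BS(i,j) = ⟨t, a | t aⁱ t⁻¹ = aʲ⟩` as a presented group. -/
abbrev BS (i j : ℤ) : Type := PresentedGroup (bsRels i j)

open RegularWreathProduct
open scoped commutatorElement

section TripleCommutator

variable {G H : Type*} [Group G] [Group H]

/-- The iterated commutator of the conjugates of `⁅x, y⁆` by `x ^ (-p)`, `x ^ (-q)`, `x ^ (-r)`. -/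
def tripleComm (p q r : ℤ) (x y : G) : G :=
  ⁅⁅x ^ (-p) * ⁅x, y⁆ * (x ^ (-p))⁻¹, x ^ (-q) * ⁅x, y⁆ * (x ^ (-q))⁻¹⁆,
    x ^ (-r) * ⁅x, y⁆ * (x ^ (-r))⁻¹⁆

theorem map_tripleComm (f : G →* H) (p q r : ℤ) (x y : G) :
    f (tripleComm p q r x y) = tripleComm p q r (f x) (f y) := by
  simp [tripleComm, map_commutatorElement]

theorem tripleComm_eq_one_of_commute (p q r : ℤ) {x y : G} (h : Commute x y) :
    tripleComm p q r x y = 1 := by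
  simp [tripleComm, commutatorElement_eq_one_iff_commute.2 h]

theorem tripleComm_eq_of_commutator_eq {x y c f : G} (h : ⁅x, y⁆ = c * f * c⁻¹) (p q r : ℤ) :
    tripleComm p q r x y =
      ⁅⁅(x ^ (-p) * c) * f * (x ^ (-p) * c)⁻¹, (x ^ (-q) * c) * f * (x ^ (-q) * c)⁻¹⁆,
        (x ^ (-r) * c) * f * (x ^ (-r) * c)⁻¹⁆ := by
  simp only [tripleComm, h]
  group

end TripleCommutator

namespace RegularWreathProduct

variable {D Q : Type*} [Group D] [Group Q]

/-- The inclusion of the base group into the wreath product. -/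
def base : (Q → D) →* D ≀ᵣ Q where
  toFun f := ⟨f, 1⟩
  map_one' := rfl
  map_mul' _ _ := by ext <;> simp

@[simp] theorem left_base (f : Q → D) : (base f).left = f := rfl

@[simp] theorem right_base (f : Q → D) : (base f).right = 1 := rfl

theorem base_injective : Function.Injective (base : (Q → D) →* D ≀ᵣ Q) := fun _ _ h =>
  congrArg left h

theorem conj_base (g : D ≀ᵣ Q) (f : Q → D) :
    g * base f * g⁻¹ = base fun x => g.left x * f (g.right⁻¹ * x) * (g.left x)⁻¹ := by
  ext <;> simp

theorem commutator_conj_base_eq_one (f : Q → D) (g₁ g₂ g₃ : D ≀ᵣ Q)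
    (h : ∀ x, f (g₁.right⁻¹ * x) ≠ 1 → f (g₂.right⁻¹ * x) ≠ 1 → f (g₃.right⁻¹ * x) = 1) :
    ⁅⁅g₁ * base f * g₁⁻¹, g₂ * base f * g₂⁻¹⁆, g₃ * base f * g₃⁻¹⁆ = 1 := by
  simp only [conj_base, ← map_commutatorElement]
  rw [← map_one base]
  congr 1
  funext x
  simp only [commutatorElement_def, Pi.mul_apply, Pi.inv_apply, Pi.one_apply]
  by_cases h₁ : f (g₁.right⁻¹ * x) = 1
  · simp [h₁]
  by_cases h₂ : f (g₂.right⁻¹ * x) = 1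
  · simp [h₂]
  · simp only [h x h₁ h₂]
    group

theorem commutator_inl_conj_inl (g : Q → D) (a c : Q) (hac : Commute a c) :
    ⁅(inl a : D ≀ᵣ Q), base g * inl c * (base g)⁻¹⁆ =
      base fun x => g (a⁻¹ * x) * (g (c⁻¹ * (a⁻¹ * x)))⁻¹ * g (c⁻¹ * x) * (g x)⁻¹ := by
  have h : ∀ x, a * (c⁻¹ * (a⁻¹ * x)) = c⁻¹ * x := fun x => by
    rw [← mul_assoc, ← mul_assoc, hac.inv_right.eq, mul_inv_cancel_right]
  ext
  · simp [commutatorElement_def, mul_assoc, h]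
  · simpa [commutatorElement_def] using commutatorElement_eq_one_iff_commute.2 hac

end RegularWreathProduct

/-- Every group embeds in another one so that the image consists of commutators. -/
theorem exists_embedding_commutator (C : Type) [Group C] :
    ∃ (E : Type) (_ : Group E) (ι φ : C →* E) (b : E),
      Function.Injective ι ∧ ∀ c, ι c = ⁅φ c, b⁆ := by
  let S : C →* (Multiplicative ℤ → C) :=
    { toFun := fun c n => if 0 ≤ n.toAdd then c else 1
      map_one' := by ext; simp
      map_mul' := fun c d => by ext n; by_cases h : 0 ≤ n.toAdd <;> simp [h] }
  refine ⟨C ≀ᵣ Multiplicative ℤ, inferInstance,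
    base.comp (MonoidHom.mulSingle (fun _ => C) 1), base.comp S,
    inl (Multiplicative.ofAdd 1), fun c d h => Pi.mulSingle_injective 1 (base_injective h),
    fun c => ?_⟩
  ext n
  · induction n with | ofAdd n => ?_
    simp only [commutatorElement_def]
    rcases lt_trichotomy n 0 with h | h | h
    · simp [S, h.ne, h.not_ge, show ¬ 1 ≤ n by omega]
    · simp [S, h]
    · simp [S, h.ne', h.le, show 1 ≤ n by omega]
  · simp [commutatorElement_def]

theorem exists_embedding_triple_commutator (C : Type) [Group C] :
    ∃ (E : Type) (_ : Group E) (ι : C →* E) (e : C → Fin 3 → E),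
      Function.Injective ι ∧ ∀ c, ι c = ⁅⁅e c 0, e c 1⁆, e c 2⁆ := by
  obtain ⟨E, _, ι, φ, b, hι, h⟩ := exists_embedding_commutator C
  obtain ⟨E', _, ι', φ', b', hι', h'⟩ := exists_embedding_commutator E
  refine ⟨E', _, ι'.comp ι, fun c => ![φ' (φ c), φ' b, b'], hι'.comp hι, fun c => ?_⟩
  simp [h', h c, map_commutatorElement]

theorem three_pow_add_eq {a b c d : ℕ} (h : 3 ^ a + 3 ^ b = 3 ^ c + 3 ^ d) :
    a = c ∧ b = d ∨ a = d ∧ b = c := by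
  have key : ∀ {a b : ℕ}, a < b → 3 * 3 ^ a ≤ 3 ^ b := fun h => by
    rw [← pow_succ']; exact Nat.pow_le_pow_right (by norm_num) h
  have inj : ∀ {a b : ℕ}, 3 ^ a = 3 ^ b → a = b := fun h =>
    Nat.pow_right_injective (a := 3) (by norm_num) h
  have pos : ∀ a : ℕ, 0 < 3 ^ a := fun a => by positivity
  have := pos a; have := pos b; have := pos c; have := pos d
  by_cases h₁ : a = c
  · subst h₁; exact .inl ⟨rfl, inj (by omega)⟩
  by_cases h₂ : a = d
  · subst h₂; exact .inr ⟨rfl, inj (by omega)⟩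
  by_cases h₃ : b = c
  · subst h₃; exact absurd (inj (by omega)) h₂
  by_cases h₄ : b = d
  · subst h₄; exact absurd (inj (by omega)) h₁
  exfalso
  rcases Nat.lt_or_gt_of_ne h₁ with h₁ | h₁ <;> rcases Nat.lt_or_gt_of_ne h₂ with h₂ | h₂ <;>
  rcases Nat.lt_or_gt_of_ne h₃ with h₃ | h₃ <;> rcases Nat.lt_or_gt_of_ne h₄ with h₄ | h₄ <;>
  have := key h₁ <;> have := key h₂ <;> have := key h₃ <;> have := key h₄ <;> omega

theorem exists_sidon (κ : Type) [Countable κ] :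
    ∃ P : κ → ℤ, (∀ k, 0 < P k) ∧
      ∀ a b c d, P a + P b = P c + P d → a = c ∧ b = d ∨ a = d ∧ b = c := by
  obtain ⟨f, hf⟩ := Countable.exists_injective_nat κ
  refine ⟨fun k => 3 ^ f k, fun k => by positivity, fun a b c d h => ?_⟩
  simpa only [hf.eq_iff] using
    three_pow_add_eq (a := f a) (b := f b) (c := f c) (d := f d)
      (by dsimp only at h; exact_mod_cast h)

theorem exists_discrete_primitive {E : Type} [Group E] (F : ℤ → E) (hF : ∀ n ≤ 0, F n = 1) :
    ∃ H : ℤ → E, ∀ n, H (n - 1) * (H n)⁻¹ = F n := by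
  let H' : ℕ → E := fun n => Nat.rec 1 (fun n x => (F (n + 1))⁻¹ * x) n
  refine ⟨fun n => H' n.toNat, fun n => ?_⟩
  rcases le_or_gt n 0 with h | h
  · simp [hF n h, Int.toNat_of_nonpos h, Int.toNat_of_nonpos (show n - 1 ≤ 0 by omega)]
  · obtain ⟨k, rfl⟩ : ∃ k : ℕ, n = k + 1 := ⟨(n - 1).toNat, by omega⟩
    simp [H', show ((k : ℤ) + 1).toNat = k + 1 by omega]

theorem tripleComm_eq_one_of_sparse {κ E : Type} [Group E] {P : κ → ℤ}
    (hP : ∀ a b c d, P a + P b = P c + P d → a = c ∧ b = d ∨ a = d ∧ b = c)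
    {f : Multiplicative (ℤ × ℤ) → E} (hf : ∀ x, f x ≠ 1 → x.toAdd.2 = 0 ∧ ∃ k, P k = x.toAdd.1)
    {A B c : E ≀ᵣ Multiplicative (ℤ × ℤ)} (hc : ⁅A, B⁆ = c * base f * c⁻¹)
    (hA : A.right.toAdd.2 ≠ 0 ∨ A.right.toAdd = (-1, 0)) {k : Fin 3 → κ}
    (hk : Function.Injective k) : tripleComm (P (k 0)) (P (k 1)) (P (k 2)) A B = 1 := by
  have h₀₁ : k 0 ≠ k 1 := hk.ne (by decide)
  have h₁₂ : k 1 ≠ k 2 := hk.ne (by decide)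
  have h₀₂ : k 0 ≠ k 2 := hk.ne (by decide)
  have pow_right : ∀ n : ℤ, (A ^ n).right = A.right ^ n := fun n => map_zpow rightHom A n
  rw [tripleComm_eq_of_commutator_eq hc]
  refine commutator_conj_base_eq_one _ _ _ _ fun x hx₀ hx₁ => ?_
  by_contra hx₂
  obtain ⟨y₀, s₀, z₀⟩ := hf _ hx₀
  obtain ⟨y₁, s₁, z₁⟩ := hf _ hx₁
  obtain ⟨y₂, s₂, z₂⟩ := hf _ hx₂
  simp only [mul_right, pow_right, toAdd_mul, toAdd_inv, toAdd_zpow, Prod.snd_add, Prod.snd_neg,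
    Prod.smul_snd, Prod.fst_add, Prod.fst_neg, Prod.smul_fst, smul_eq_mul] at *
  rcases hA with hA | hA
  · have : (P (k 0) - P (k 1)) * A.right.toAdd.2 = 0 := by linarith
    have h : P (k 0) = P (k 1) := by
      rcases mul_eq_zero.1 this with h | h
      · linarith
      · exact absurd h hA
    rcases hP (k 0) (k 0) (k 1) (k 1) (by linarith) with h | h
    exacts [h₀₁ h.1, h₀₁ h.1]
  · simp only [hA] at z₀ z₁ z₂
    have h₁ := hP s₀ (k 0) s₁ (k 1) (by linarith)
    have h₂ := hP s₀ (k 0) s₂ (k 2) (by linarith)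
    grind

/-- Every countable group embeds in a group with elements `X`, `Y` so that each member of the image
is the value at `(X, Y)` of a `tripleComm` word that is trivial at several other pairs of words in
`X` and `Y`. -/
theorem exists_tripleComm_pair (C : Type) [Group C] [Countable C] :
    ∃ (D : Type) (_ : Group D) (X Y : D) (ι : C →* D) (p : C → Fin 3 → ℤ),
      Function.Injective ι ∧ ∀ c,
        tripleComm (p c 0) (p c 1) (p c 2) X Y = ι c ∧
        tripleComm (p c 0) (p c 1) (p c 2) X⁻¹ Y⁻¹ = 1 ∧
        tripleComm (p c 0) (p c 1) (p c 2) (X⁻¹ * Y) X⁻¹ = 1 ∧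
        tripleComm (p c 0) (p c 1) (p c 2) (Y⁻¹ * X) X = 1 ∧
        tripleComm (p c 0) (p c 1) (p c 2) Y⁻¹ (Y⁻¹ * X) = 1 ∧
        tripleComm (p c 0) (p c 1) (p c 2) Y (X⁻¹ * Y) = 1 := by
  obtain ⟨E, _, ι, e, hι, he⟩ := exists_embedding_triple_commutator C
  obtain ⟨P, hpos, hP⟩ := exists_sidon (C × Fin 3)
  have hinj : Function.Injective P := fun a b h => by
    rcases hP a a b b (by rw [h]) with h | h
    exacts [h.1, h.1]
  let F : ℤ → E := Function.extend P (fun k => e k.1 k.2) 1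
  have hF : ∀ k, F (P k) = e k.1 k.2 := fun k => hinj.extend_apply _ _ k
  have hF' : ∀ n, F n ≠ 1 → ∃ k, P k = n := fun n hn => by
    by_contra h
    exact hn (Function.extend_apply' _ _ n h)
  obtain ⟨H, hH⟩ := exists_discrete_primitive F fun n hn => by
    by_contra h
    obtain ⟨k, rfl⟩ := hF' n h
    exact (hpos k).not_ge hn
  let f : Multiplicative (ℤ × ℤ) → E := fun x => if x.toAdd.2 = 0 then F x.toAdd.1 else 1
  have hf : ∀ x, f x ≠ 1 → x.toAdd.2 = 0 ∧ ∃ k, P k = x.toAdd.1 := fun x hx => by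
    by_cases h : x.toAdd.2 = 0
    · exact ⟨h, hF' _ (by simpa [f, h] using hx)⟩
    · simp [f, h] at hx
  let X : E ≀ᵣ Multiplicative (ℤ × ℤ) := inl (Multiplicative.ofAdd (1, 0))
  let Y : E ≀ᵣ Multiplicative (ℤ × ℤ) :=
    ⟨fun x => if x.toAdd.2 = 0 then H x.toAdd.1 else 1, Multiplicative.ofAdd (0, 1)⟩
  have hXY : ⁅X, Y⁆ = base f := by
    refine RegularWreathProduct.ext (funext fun x => ?_) ?_
    · by_cases h : x.toAdd.2 = 0
      · simp [X, Y, f, commutatorElement_def, h, ← hH, sub_eq_neg_add]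
      · simp [X, Y, f, commutatorElement_def, h]
    · simp [X, Y, commutatorElement_def]
  have hX : X.right = Multiplicative.ofAdd (1, 0) := rfl
  have hY : Y.right = Multiplicative.ofAdd (0, 1) := rfl
  have hk : ∀ c : C, Function.Injective fun i : Fin 3 => (c, i) := fun c _ _ h => congrArg Prod.snd h
  refine ⟨E ≀ᵣ Multiplicative (ℤ × ℤ), inferInstance, X, Y,
    base.comp ((MonoidHom.mulSingle (fun _ => E) 1).comp ι),
    fun c i => P (c, i), fun a b h => hι (Pi.mulSingle_injective 1 (base_injective h)),
    fun c => ⟨?_, ?_, ?_, ?_, ?_, ?_⟩⟩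
  · have hX' : ∀ n : ℤ, X ^ n = inl (Multiplicative.ofAdd (n, 0)) := fun n => by
      rw [← map_zpow, ← ofAdd_zsmul]; simp
    rw [tripleComm, hXY]
    simp only [hX', conj_base, ← map_commutatorElement, MonoidHom.comp_apply]
    congr 1
    funext x
    by_cases hx : x = 1
    · subst hx
      simp [commutatorElement_def, he, f, hF]
    · rw [MonoidHom.mulSingle_apply, Pi.mulSingle_eq_of_ne hx]
      simp only [commutatorElement_def, Pi.mul_apply, Pi.inv_apply]
      by_cases h₀ : f ((Multiplicative.ofAdd (-P (c, 0), (0 : ℤ)))⁻¹ * x) = 1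
      · simp [h₀]
      by_cases h₁ : f ((Multiplicative.ofAdd (-P (c, 1), (0 : ℤ)))⁻¹ * x) = 1
      · simp [h₁]
      obtain ⟨y₀, s₀, z₀⟩ := hf _ h₀
      obtain ⟨y₁, s₁, z₁⟩ := hf _ h₁
      simp only [toAdd_mul, toAdd_inv, toAdd_ofAdd, Prod.fst_add, Prod.fst_neg, neg_neg,
        Prod.snd_add, Prod.snd_neg, neg_zero, zero_add] at y₀ z₀ z₁
      refine absurd (Multiplicative.toAdd.injective (Prod.ext ?_ y₀)) hx
      rcases hP s₀ (c, 1) s₁ (c, 0) (by linarith) with h | h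
      · simp at h
      · rw [h.1] at z₀
        simpa using z₀
  · refine tripleComm_eq_one_of_sparse hP hf (c := (Y * X)⁻¹) ?_ (.inr ?_) (hk c)
    · rw [← hXY]; simp [commutatorElement_def, mul_assoc]
    · simp [hX]
  · refine tripleComm_eq_one_of_sparse hP hf (c := X⁻¹ * X⁻¹) ?_ (.inl ?_) (hk c)
    · rw [← hXY]; simp [commutatorElement_def, mul_assoc]
    · simp [hX, hY]
  · refine tripleComm_eq_one_of_sparse hP hf (c := Y⁻¹) ?_ (.inl ?_) (hk c)
    · rw [← hXY]; simp [commutatorElement_def, mul_assoc]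
    · simp [hX, hY]
  · refine tripleComm_eq_one_of_sparse hP hf (c := Y⁻¹ * Y⁻¹) ?_ (.inl ?_) (hk c)
    · rw [← hXY]; simp [commutatorElement_def, mul_assoc]
    · simp [hY]
  · refine tripleComm_eq_one_of_sparse hP hf (c := X⁻¹) ?_ (.inl ?_) (hk c)
    · rw [← hXY]; simp [commutatorElement_def, mul_assoc]
    · simp [hY]

/-- If `2 ≤ m` and `3 ≤ n`, every countable group embeds in a group with elements `α`, `β`
satisfying `α ^ m = 1` and `β ^ n = 1`, so that the image consists of values at `(α, β)` of
`tripleComm` words in `⁅α, β⁻¹⁆` and `⁅α, (β ^ 2)⁻¹⁆`. -/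
theorem exists_tripleComm_torsion (C : Type) [Group C] [Countable C] {m n : ℕ} (hm : 2 ≤ m)
    (hn : 3 ≤ n) :
    ∃ (M : Type) (_ : Group M) (α β : M) (ι : C →* M) (p : C → Fin 3 → ℤ),
      α ^ m = 1 ∧ β ^ n = 1 ∧ Function.Injective ι ∧
      ∀ c, tripleComm (p c 0) (p c 1) (p c 2) ⁅α, β⁻¹⁆ ⁅α, (β ^ 2)⁻¹⁆ = ι c := by
  obtain ⟨D, _, X, Y, ι, p, hι, hw⟩ := exists_tripleComm_pair C
  let k : ZMod n → D := fun q => if q = 1 then X⁻¹ else if q = 2 then Y⁻¹ else 1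
  let g : Multiplicative (ZMod m × ZMod n) → D := fun x => if x.toAdd.1 = 0 then k x.toAdd.2 else 1
  let a : Multiplicative (ZMod m × ZMod n) := Multiplicative.ofAdd (1, 0)
  let b : Multiplicative (ZMod m × ZMod n) := Multiplicative.ofAdd (0, 1)
  let α : D ≀ᵣ Multiplicative (ZMod m × ZMod n) := inl a
  let β : D ≀ᵣ Multiplicative (ZMod m × ZMod n) := base g * inl b * (base g)⁻¹
  have hα : α ^ m = 1 := by
    rw [← map_pow, ← ofAdd_nsmul]; simp [← Prod.zero_eq_mk]
  have hβ : β ^ n = 1 := by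
    rw [conj_pow, ← map_pow, ← ofAdd_nsmul]; simp [← Prod.zero_eq_mk]
  have h₁ : β⁻¹ = base g * inl b⁻¹ * (base g)⁻¹ := by
    rw [map_inv, conj_inv]
  have h₂ : (β ^ 2)⁻¹ = base g * inl (b ^ 2)⁻¹ * (base g)⁻¹ := by
    rw [conj_pow, conj_inv, map_inv, map_pow]
  refine ⟨D ≀ᵣ Multiplicative (ZMod m × ZMod n), inferInstance, α, β,
    base.comp ((MonoidHom.mulSingle (fun _ => D) a).comp ι), p, hα, hβ,
    fun x y h => hι (Pi.mulSingle_injective a (base_injective h)), fun c => ?_⟩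
  rw [h₁, h₂, commutator_inl_conj_inl _ _ _ (Commute.all _ _),
    commutator_inl_conj_inl _ _ _ (Commute.all _ _), ← map_tripleComm]
  simp only [MonoidHom.comp_apply]
  congr 1
  funext x
  refine (map_tripleComm (Pi.evalMonoidHom (fun _ => D) x) _ _ _ _ _).trans ?_
  obtain ⟨w₁, w₂, w₃, w₄, w₅, w₆⟩ := hw c
  have : Fact (1 < m) := ⟨hm⟩
  have : Fact (1 < n) := ⟨by omega⟩
  have d₂ : (2 : ZMod n) ≠ 0 := fun h => by
    have := (ZMod.natCast_eq_zero_iff 2 n).1 (by exact_mod_cast h)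
    exact absurd (Nat.le_of_dvd (by norm_num) this) (by omega)
  induction x with | ofAdd x => ?_
  obtain ⟨x, q⟩ := x
  rw [MonoidHom.mulSingle_apply, Pi.mulSingle_apply]
  simp [g, a, b]
  have d₁ : (1 : ZMod n) ≠ 0 := one_ne_zero
  have k₀ : k 0 = 1 := by simp [k, d₁.symm, d₂.symm]
  have k₁ : k 1 = X⁻¹ := by simp [k]
  have k₂ : k 2 = Y⁻¹ := by
    simp [k, show (2 : ZMod n) ≠ 1 from fun h => d₁ (by linear_combination h)]
  have k₃ : k (1 + 2) = 1 := by
    simp [k, show (1 + 2 : ZMod n) ≠ 1 from fun h => d₂ (by linear_combination h),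
      show (1 + 2 : ZMod n) ≠ 2 from fun h => d₁ (by linear_combination h)]
  have k₄ : k (2 + 2) = X⁻¹ ∨ k (2 + 2) = 1 := by
    simp only [k, if_neg (show (2 + 2 : ZMod n) ≠ 2 from fun h => d₂ (by linear_combination h))]
    exact ite_eq_or_eq _ _ _
  have k₅ : ∀ q, q ≠ 0 → q ≠ 1 → q ≠ 2 → k q = 1 ∧ k (1 + q) = 1 := fun q h₀ h₁ h₂ => by
    simp [k, h₀, h₁, h₂, show 1 + q ≠ 2 from fun h => h₁ (by linear_combination h)]
  have k₆ : k (2 + 1) = 1 := by rw [add_comm]; exact k₃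
  have k₇ : k (1 + 1) = Y⁻¹ := by rw [one_add_one_eq_two]; exact k₂
  have q₀ : q = 0 ∨ q = 1 ∨ q = 2 ∨ k q = 1 ∧ k (1 + q) = 1 ∧ q ≠ 0 := by
    by_cases h₀ : q = 0
    · exact .inl h₀
    by_cases h₁ : q = 1
    · exact .inr (.inl h₁)
    by_cases h₂ : q = 2
    · exact .inr (.inr (.inl h₂))
    exact .inr (.inr (.inr ⟨(k₅ q h₀ h₁ h₂).1, (k₅ q h₀ h₁ h₂).2, h₀⟩))
  have one_left : ∀ p q r (x : D), tripleComm p q r 1 x = 1 := fun p q r x =>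
    tripleComm_eq_one_of_commute _ _ _ (Commute.one_left x)
  have self : ∀ p q r (x : D), tripleComm p q r x x = 1 := fun p q r x =>
    tripleComm_eq_one_of_commute _ _ _ (Commute.refl x)
  by_cases hx₀ : x = 0
  · subst hx₀
    rcases q₀ with rfl | rfl | rfl | ⟨h, h', h''⟩
    · simp [k₀, k₁, k₂, w₂]
    · simp [k₁, k₆, k₇, w₄]
    · rcases k₄ with h | h <;> simp [k₂, k₃, h, w₆, self]
    · simp [h, h', one_left]
  · by_cases hx₁ : x = 1
    · subst hx₁
      rcases q₀ with rfl | rfl | rfl | ⟨h, h', h''⟩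
      · simp [k₀, k₁, k₂, w₁]
      · simp [k₁, k₆, k₇, w₃, d₁]
      · rcases k₄ with h | h <;> simp [k₂, k₃, h, w₅, self, d₂]
      · simp [h, h', h'', one_left]
    · simp [hx₀, hx₁, show -1 + x ≠ 0 from fun h => hx₁ (by linear_combination h), one_left]

theorem exists_hom_BS {K : Type*} [Group K] {i j : ℤ} {t a : K} (h : t * a ^ i * t⁻¹ = a ^ j) :
    ∃ ψ : BS i j →* K, ∃ u v, ψ u = t ∧ ψ v = a := by
  have hr : ∀ r ∈ bsRels i j, FreeGroup.lift ![t, a] r = 1 := by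
    rintro _ rfl
    simp [h]
  exact ⟨PresentedGroup.toGroup hr, PresentedGroup.of 0, PresentedGroup.of 1,
    by simp, by simp⟩

theorem exists_embedding_quotient {G K C : Type*} [Group G] [Group K] [Group C] (ψ : G →* K)
    (ι : C →* K) (hι : Function.Injective ι) (h : ∀ c, ι c ∈ ψ.range) :
    ∃ (N : Subgroup G) (_ : N.Normal), ∃ f : C →* G ⧸ N, Function.Injective f :=
  ⟨ψ.ker, inferInstance, (QuotientGroup.quotientKerEquivRange ψ).symm.toMonoidHom.comp
    (ι.codRestrict ψ.range h), (QuotientGroup.quotientKerEquivRange ψ).symm.injective.comp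
      ((MonoidHom.injective_codRestrict _ _ _).2 hι)⟩

/-- Two elements of infinite order become conjugate in a larger group. -/
theorem exists_embedding_conj {G : Type} [Group G] {x y : G}
    (hx : Function.Injective fun n : ℤ => x ^ n) (hy : Function.Injective fun n : ℤ => y ^ n) :
    ∃ (K : Type) (_ : Group K) (f : G →* K) (t : K),
      Function.Injective f ∧ t * f x * t⁻¹ = f y := by
  have hx' : Function.Injective (zpowersHom G x) := fun m n h =>
    Multiplicative.toAdd.injective (hx (by simpa using h))
  have hy' : Function.Injective (zpowersHom G y) := fun m n h =>
    Multiplicative.toAdd.injective (hy (by simpa using h))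
  let φ := (MonoidHom.ofInjective hx').symm.trans (MonoidHom.ofInjective hy')
  refine ⟨HNNExtension G _ _ φ, inferInstance, HNNExtension.of, HNNExtension.t,
    HNNExtension.of_injective _ , ?_⟩
  have := HNNExtension.t_mul_of (φ := φ) (MonoidHom.ofInjective hx' (Multiplicative.ofAdd 1))
  rw [mul_inv_eq_iff_eq_mul]
  simpa [φ, MonoidHom.ofInjective_apply] using this

theorem tripleComm_mk {A M : Type*} [CommGroup A] [Group M] (p q r : ℤ) (z w : A) (α β : M) :
    tripleComm p q r ⁅(z, α), (w, β)⁻¹⁆ ⁅(z, α), ((w, β) ^ 2)⁻¹⁆ =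
      (1, tripleComm p q r ⁅α, β⁻¹⁆ ⁅α, (β ^ 2)⁻¹⁆) := by
  refine Prod.ext ?_ ?_
  · exact (map_tripleComm (MonoidHom.fst A M) _ _ _ _ _).trans
      (tripleComm_eq_one_of_commute _ _ _ (Commute.all _ _))
  · refine (map_tripleComm (MonoidHom.snd A M) _ _ _ _ _).trans ?_
    simp [map_commutatorElement]

theorem tripleComm_commutator_mem_range {G K : Type*} [Group G] [Group K] (ψ : G →* K)
    (p q r : ℤ) {x y : K}
    (hx : x ∈ ψ.range) (hy : y ∈ ψ.range) :
    tripleComm p q r ⁅x, y⁻¹⁆ ⁅x, (y ^ 2)⁻¹⁆ ∈ ψ.range := by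
  obtain ⟨u, rfl⟩ := hx
  obtain ⟨v, rfl⟩ := hy
  exact ⟨tripleComm p q r ⁅u, v⁻¹⁆ ⁅u, (v ^ 2)⁻¹⁆, by
    simp only [map_tripleComm, map_commutatorElement, map_inv, map_pow]⟩

theorem injective_zpow_mk {M : Type*} [Group M] {i : ℤ} (hi : i ≠ 0) (α : M) :
    Function.Injective fun n : ℤ => ((Multiplicative.ofAdd i, α) : Multiplicative ℤ × M) ^ n :=
  fun m n h => by
    have := congrArg (fun z => z.1.toAdd) h
    simpa [hi] using this

/-- For all integers `i, j` with `|i| > 1` and `|j| > 1`, the Baumslag–Solitar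
group `BS(i,j)` is SQ-universal. -/
theorem stmt_11 (i j : ℤ) (hi : 1 < |i|) (hj : 1 < |j|) : SQUniversal (BS i j) := by
  intro C _ _
  rw [Int.abs_eq_natAbs] at hi hj
  have hi₀ : i ≠ 0 := by omega
  have hj₀ : j ≠ 0 := by omega
  have comm : ∀ {M : Type} [Group M] {α β : M}, α ^ j = 1 → β ^ i = 1 →
      ((Multiplicative.ofAdd i, α) : Multiplicative ℤ × M) ^ j = (Multiplicative.ofAdd j, β) ^ i :=
    fun hα hβ => by
      ext
      · exact congrArg Multiplicative.ofAdd (mul_comm j i)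
      · simp [hα, hβ]
  by_cases h₃ : 3 ≤ i.natAbs
  · obtain ⟨M, _, α, β, ι, p, hα, hβ, hι, hc⟩ :=
      exists_tripleComm_torsion C (m := j.natAbs) (n := i.natAbs) (by omega) h₃
    obtain ⟨K, _, f, t, hf, ht⟩ := exists_embedding_conj (injective_zpow_mk hi₀ α)
      (injective_zpow_mk hj₀ β)
    obtain ⟨ψ, u, v, rfl, hv⟩ := exists_hom_BS (i := i) (j := j) (t := t)
      (a := f (Multiplicative.ofAdd i, α)) (by
        rw [← conj_zpow, ht, ← map_zpow, ← map_zpow,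
          comm (pow_natAbs_eq_one.1 hα) (pow_natAbs_eq_one.1 hβ)])
    refine exists_embedding_quotient ψ (f.comp ((MonoidHom.inr _ M).comp ι))
      (hf.comp ((Prod.mk_right_injective _).comp hι)) fun c => ?_
    have := tripleComm_commutator_mem_range ψ (p c 0) (p c 1) (p c 2) ⟨v, hv⟩
      (y := f (Multiplicative.ofAdd j, β)) ⟨u * v * u⁻¹, by simp [hv, ht]⟩
    rwa [← map_inv, ← map_pow, ← map_inv, ← map_commutatorElement, ← map_commutatorElement,
      ← map_tripleComm, tripleComm_mk, hc] at this
  by_cases h₃ : 3 ≤ j.natAbs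
  · obtain ⟨M, _, α, β, ι, p, hα, hβ, hι, hc⟩ :=
      exists_tripleComm_torsion C (m := i.natAbs) (n := j.natAbs) (by omega) h₃
    obtain ⟨K, _, f, t, hf, ht⟩ := exists_embedding_conj (injective_zpow_mk hi₀ β)
      (injective_zpow_mk hj₀ α)
    obtain ⟨ψ, u, v, rfl, hv⟩ := exists_hom_BS (i := i) (j := j) (t := t)
      (a := f (Multiplicative.ofAdd i, β)) (by
        rw [← conj_zpow, ht, ← map_zpow, ← map_zpow,
          comm (pow_natAbs_eq_one.1 hβ) (pow_natAbs_eq_one.1 hα)])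
    refine exists_embedding_quotient ψ (f.comp ((MonoidHom.inr _ M).comp ι))
      (hf.comp ((Prod.mk_right_injective _).comp hι)) fun c => ?_
    have := tripleComm_commutator_mem_range ψ (p c 0) (p c 1) (p c 2)
      (x := f (Multiplicative.ofAdd j, α))
      ⟨u * v * u⁻¹, by simp [hv, ht]⟩ ⟨v, hv⟩
    rwa [← map_inv, ← map_pow, ← map_inv, ← map_commutatorElement, ← map_commutatorElement,
      ← map_tripleComm, tripleComm_mk, hc] at this
  · obtain ⟨M, _, α, β, ι, p, hα, -, hι, hc⟩ :=
      exists_tripleComm_torsion C (m := 2) (n := 3) le_rfl le_rfl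
    have hi₂ : i.natAbs = 2 := by omega
    have hj₂ : j.natAbs = 2 := by omega
    obtain ⟨ψ, u, v, rfl, rfl⟩ := exists_hom_BS (i := i) (j := j) (t := β) (a := α) (by
      rw [pow_natAbs_eq_one.1 (hi₂ ▸ hα), pow_natAbs_eq_one.1 (hj₂ ▸ hα)]
      simp)
    refine exists_embedding_quotient ψ ι hι fun c => ?_
    rw [← hc]
    exact tripleComm_commutator_mem_range ψ _ _ _ ⟨v, rfl⟩ ⟨u, rfl⟩
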